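/- arXiv:1405.0209 — 4 statements merged into one kernel-verified Lean document; each statement's English description precedes it below -/
import Mathlib

section
/- Let λ > 0 and let m ≥ 2 be an integer. Consider the probability measure μ on the region {(r,R) ∈ ℝ² : 0 < r < R} whose density with respect to two-dimensional Lebesgue measure is f(r,R) = 2πλ r e^{−πλ r²} · (2πλ R/(m−2)!) · e^{−πλ(R²−r²)} · (πλ(R²−r²))^{m−2}. Then the pushforward of μ under the map (r,R) ↦ R/r is absolutely continuous with respect to Lebesgue measure on ℝ, with density g_m(β) = 2(m−1)β^{1−2m}(β²−1)^{m−2} for β > 1 and g_m(β) = 0 otherwise. In particular, the distribution of the ratio R/r does not depend on λ. -/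
open MeasureTheory Real

open Set ENNReal in
theorem map_div_withDensity {f : ℝ × ℝ → ℝ≥0∞} (hf : Measurable f) :
    Measure.map (fun p : ℝ × ℝ => p.2 / p.1) (volume.withDensity f) =
      volume.withDensity (fun β : ℝ => ∫⁻ r : ℝ, ENNReal.ofReal |r| * f (r, r * β)) := by
  have hdiv : Measurable (fun p : ℝ × ℝ => p.2 / p.1) := by fun_prop
  ext s hs
  have hind : Measurable (s.indicator (1 : ℝ → ℝ≥0∞)) := measurable_one.indicator hs
  rw [Measure.map_apply hdiv hs, withDensity_apply _ (hdiv hs), withDensity_apply _ hs,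
    ← lintegral_indicator (hdiv hs), ← lintegral_indicator hs, Measure.volume_eq_prod,
    lintegral_prod _ (hf.indicator (hdiv hs)).aemeasurable]
  calc
    _ = ∫⁻ r : ℝ, ∫⁻ β : ℝ,
          ENNReal.ofReal |r| * f (r, r * β) * s.indicator (1 : ℝ → ℝ≥0∞) β := by
      refine lintegral_congr_ae ?_
      filter_upwards [Measure.ae_ne volume (0 : ℝ)] with r hr
      have hmeas : Measurable fun R : ℝ =>
          ((fun p : ℝ × ℝ => p.2 / p.1) ⁻¹' s).indicator f (r, R) :=
        (hf.indicator (hdiv hs)).comp (by fun_prop)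
      rw [← Real.smul_map_volume_mul_left hr, lintegral_smul_measure,
        lintegral_map hmeas (by fun_prop), Real.smul_map_volume_mul_left hr, smul_eq_mul,
        ← lintegral_const_mul' _ _ ofReal_ne_top]
      refine lintegral_congr fun β => ?_
      by_cases hβ : β ∈ s <;> simp [Set.indicator, hβ, mul_div_cancel_left₀ _ hr]
    _ = ∫⁻ β : ℝ, ∫⁻ r : ℝ,
          ENNReal.ofReal |r| * f (r, r * β) * s.indicator (1 : ℝ → ℝ≥0∞) β := by
      refine lintegral_lintegral_swap (Measurable.aemeasurable ?_)
      change Measurable fun p : ℝ × ℝ =>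
        ENNReal.ofReal |p.1| * f (p.1, p.1 * p.2) * s.indicator (1 : ℝ → ℝ≥0∞) p.2
      fun_prop
    _ = _ := by
      refine lintegral_congr fun β => ?_
      by_cases hβ : β ∈ s <;> simp [hβ]

theorem lintegral_pow_mul_exp_neg_mul_sq (k : ℕ) {b : ℝ} (hb : 0 < b) :
    ∫⁻ r in Set.Ioi (0 : ℝ), ENNReal.ofReal (r ^ (2 * k + 3) * Real.exp (-(b * r ^ 2))) =
      ENNReal.ofReal ((k + 1).factorial / (2 * b ^ (k + 2))) := by
  have hcongr : Set.EqOn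
      (fun r : ℝ => r ^ (2 * k + 3 : ℝ) * Real.exp (-b * r ^ (2 : ℝ)))
      (fun r : ℝ => r ^ (2 * k + 3) * Real.exp (-(b * r ^ 2))) (Set.Ioi 0) := by
    intro r _
    simp only [neg_mul, Real.rpow_two]
    congr 1
    exact_mod_cast Real.rpow_natCast r (2 * k + 3)
  have hk : (-1 : ℝ) < 2 * k + 3 := by linarith [(Nat.cast_nonneg k : (0 : ℝ) ≤ k)]
  have hint := (integrableOn_rpow_mul_exp_neg_mul_rpow hk (by norm_num) hb).congr_fun hcongr
    measurableSet_Ioi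
  rw [← ofReal_integral_eq_lintegral_ofReal hint, ← setIntegral_congr_fun measurableSet_Ioi hcongr,
    integral_rpow_mul_exp_neg_mul_rpow (by norm_num) hk hb]
  · congr 1
    have e1 : ((2 * k + 3 : ℝ) + 1) / 2 = ((k + 1 : ℕ) : ℝ) + 1 := by push_cast; ring
    have e2 : -((2 * k + 3 : ℝ) + 1) / 2 = -((k + 2 : ℕ) : ℝ) := by push_cast; ring
    rw [e1, e2, Real.Gamma_nat_eq_factorial, Real.rpow_neg hb.le, Real.rpow_natCast]
    field_simp
  · filter_upwards [self_mem_ae_restrict measurableSet_Ioi] with r hr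
    have : 0 < r := hr
    simp only [Pi.zero_apply]
    positivity

/-- The pushforward under `(r, R) ↦ R / r` of the measure on
`{(r,R) : 0 < r < R}` with joint density
`f(r,R) = 2πλ r e^{−πλ r²} · (2πλ R/(m−2)!) e^{−πλ(R²−r²)} (πλ(R²−r²))^{m−2}`
has density `g_m(β) = 2(m−1) β^{1−2m} (β²−1)^{m−2}` on `(1,∞)`, independent of `λ`. -/
theorem pushforward_ratio_density (lam : ℝ) (hlam : 0 < lam) (m : ℕ) (hm : 2 ≤ m) :
    Measure.map (fun p : ℝ × ℝ => p.2 / p.1)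
      (volume.withDensity (fun p : ℝ × ℝ =>
        if 0 < p.1 ∧ p.1 < p.2 then
          ENNReal.ofReal
            ((2 * π * lam * p.1 * Real.exp (-(π * lam * p.1 ^ 2))) *
              ((2 * π * lam * p.2 / ((m - 2).factorial : ℝ)) *
                Real.exp (-(π * lam * (p.2 ^ 2 - p.1 ^ 2))) *
                (π * lam * (p.2 ^ 2 - p.1 ^ 2)) ^ (m - 2)))
        else 0)) =
    volume.withDensity (fun β : ℝ =>
      if 1 < β then
        ENNReal.ofReal (2 * ((m : ℝ) - 1) * β ^ ((1 : ℤ) - 2 * (m : ℤ)) * (β ^ 2 - 1) ^ (m - 2))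
      else 0) := by
  obtain ⟨k, rfl⟩ := Nat.exists_eq_add_of_le' hm
  have hmeas : Measurable (fun p : ℝ × ℝ =>
      if 0 < p.1 ∧ p.1 < p.2 then
        ENNReal.ofReal
          ((2 * π * lam * p.1 * Real.exp (-(π * lam * p.1 ^ 2))) *
            ((2 * π * lam * p.2 / ((k + 2 - 2).factorial : ℝ)) *
              Real.exp (-(π * lam * (p.2 ^ 2 - p.1 ^ 2))) *
              (π * lam * (p.2 ^ 2 - p.1 ^ 2)) ^ (k + 2 - 2)))
      else 0) := by
    refine Measurable.ite ?_ (by fun_prop) measurable_const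
    exact (measurableSet_lt measurable_const measurable_fst).inter
      (measurableSet_lt measurable_fst measurable_snd)
  rw [map_div_withDensity hmeas]
  congr 1
  ext1 β
  simp only [Nat.add_sub_cancel]
  split_ifs with hβ
  · have hβ0 : 0 < β := one_pos.trans hβ
    have hβ1 : 0 < β ^ 2 - 1 := by nlinarith
    set A : ℝ := 4 * (π * lam) ^ (k + 2) * β * (β ^ 2 - 1) ^ k / k.factorial with hA
    have hA0 : 0 ≤ A := by positivity
    calc
      _ = ∫⁻ r in Set.Ioi (0 : ℝ), ENNReal.ofReal A *
            ENNReal.ofReal (r ^ (2 * k + 3) * Real.exp (-(π * lam * β ^ 2 * r ^ 2))) := by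
        rw [← lintegral_indicator measurableSet_Ioi]
        refine lintegral_congr fun r => ?_
        by_cases hr : 0 < r
        · have hrβ : r < r * β := by nlinarith
          rw [Set.indicator_of_mem (Set.mem_Ioi.2 hr), if_pos ⟨hr, hrβ⟩, abs_of_pos hr,
            ← ENNReal.ofReal_mul hr.le, ← ENNReal.ofReal_mul hA0]
          congr 1
          have hexp : Real.exp (-(π * lam * β ^ 2 * r ^ 2)) =
              Real.exp (-(π * lam * r ^ 2)) *
                Real.exp (-(π * lam * ((r * β) ^ 2 - r ^ 2))) := by
            rw [← Real.exp_add]; congr 1; ring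
          have hpow : (π * lam * ((r * β) ^ 2 - r ^ 2)) ^ k =
              (π * lam) ^ k * r ^ (2 * k) * (β ^ 2 - 1) ^ k := by
            rw [pow_mul, ← mul_pow, ← mul_pow]; congr 1; ring
          rw [hexp, hpow, hA]
          ring
        · rw [Set.indicator_of_notMem (by simpa using hr), if_neg (fun h => hr h.1), mul_zero]
      _ = _ := by
        rw [lintegral_const_mul' _ _ ENNReal.ofReal_ne_top,
          lintegral_pow_mul_exp_neg_mul_sq k (by positivity), ← ENNReal.ofReal_mul hA0]
        congr 1
        have hz : β ^ ((1 : ℤ) - 2 * ((k + 2 : ℕ) : ℤ)) = β / β ^ (2 * (k + 2)) := by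
          rw [zpow_sub₀ hβ0.ne', zpow_one]
          norm_cast
        rw [hz, hA, Nat.factorial_succ, mul_pow _ (β ^ 2), ← pow_mul]
        push_cast
        field_simp
        ring
  · refine (lintegral_congr fun r => ?_).trans lintegral_zero
    rw [if_neg (fun h => hβ ?_), mul_zero]
    exact (lt_mul_iff_one_lt_right h.1).1 h.2
end

section
/- Let m ≥ 2 be an integer. Then ∫_1^∞ β · 2(m−1)β^{1−2m}(β²−1)^{m−2} dβ = √π · Γ(m)/Γ(m − 1/2), where Γ is the Gamma function. (That is, the mean of the ratio β is E[β] = √π Γ(m)/Γ(m−1/2).) -/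
open MeasureTheory Real

lemma integrableOn_inv_sq_mul_one_sub_inv_sq_pow (n : ℕ) :
    IntegrableOn (fun x : ℝ => (x ^ 2)⁻¹ * (1 - (x ^ 2)⁻¹) ^ n) (Set.Ioi 1) := by
  have h : IntegrableOn (fun x : ℝ => x ^ (-2 : ℝ)) (Set.Ioi 1) :=
    integrableOn_Ioi_rpow_of_lt (by norm_num) one_pos
  refine Integrable.mono' h (by fun_prop) ?_
  filter_upwards [ae_restrict_mem measurableSet_Ioi] with x hx
  have hx1 : (1 : ℝ) < x := hx
  have hx0 : 0 < x := by linarith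
  have h1 : (x ^ 2)⁻¹ ≤ 1 := inv_le_one_of_one_le₀ (one_le_pow₀ hx1.le)
  have h2 : 0 < (x ^ 2)⁻¹ := by positivity
  have h3 : 0 ≤ 1 - (x ^ 2)⁻¹ := by linarith
  rw [Real.norm_of_nonneg (by positivity), Real.rpow_neg hx0.le, Real.rpow_two]
  exact mul_le_of_le_one_right h2.le (pow_le_one₀ h3 (by linarith))

lemma integral_inv_sq_mul_one_sub_inv_sq_pow_succ (n : ℕ) :
    (2 * (n : ℝ) + 3) * ∫ x in Set.Ioi (1 : ℝ), (x ^ 2)⁻¹ * (1 - (x ^ 2)⁻¹) ^ (n + 1) =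
      2 * ((n : ℝ) + 1) * ∫ x in Set.Ioi (1 : ℝ), (x ^ 2)⁻¹ * (1 - (x ^ 2)⁻¹) ^ n := by
  have hderiv : ∀ x ∈ Set.Ici (1 : ℝ),
      HasDerivAt (fun x : ℝ => x⁻¹ * (1 - (x ^ 2)⁻¹) ^ (n + 1))
        (2 * ((n : ℝ) + 1) * ((x ^ 2)⁻¹ * (1 - (x ^ 2)⁻¹) ^ n) -
          (2 * (n : ℝ) + 3) * ((x ^ 2)⁻¹ * (1 - (x ^ 2)⁻¹) ^ (n + 1))) x := by
    intro x hx
    have hx0 : x ≠ 0 := by have : (1 : ℝ) ≤ x := hx; linarith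
    have h := (hasDerivAt_inv hx0).mul
      (((((hasDerivAt_id x).pow 2).inv (by simpa using hx0)).const_sub 1).pow (n + 1))
    refine h.congr_deriv ?_
    simp only [id, Pi.pow_apply, Pi.inv_apply, Nat.add_sub_cancel, pow_succ (1 - (x ^ 2)⁻¹) n]
    generalize (1 - (x ^ 2)⁻¹) ^ n = y
    push_cast
    field_simp
    ring
  have hlim : Filter.Tendsto (fun x : ℝ => x⁻¹ * (1 - (x ^ 2)⁻¹) ^ (n + 1)) Filter.atTop
      (nhds 0) := by
    have h2 : Filter.Tendsto (fun x : ℝ => (x ^ 2)⁻¹) Filter.atTop (nhds 0) :=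
      tendsto_inv_atTop_zero.comp (Filter.tendsto_pow_atTop two_ne_zero)
    simpa using tendsto_inv_atTop_zero.mul ((h2.const_sub 1).pow (n + 1))
  have hn := (integrableOn_inv_sq_mul_one_sub_inv_sq_pow n).const_mul (2 * ((n : ℝ) + 1))
  have hs := (integrableOn_inv_sq_mul_one_sub_inv_sq_pow (n + 1)).const_mul (2 * (n : ℝ) + 3)
  have h := integral_Ioi_of_hasDerivAt_of_tendsto' hderiv (hn.sub hs) hlim
  rw [integral_sub hn hs, integral_const_mul, integral_const_mul] at h
  norm_num at h
  linarith

lemma integral_inv_sq_mul_one_sub_inv_sq_pow (n : ℕ) :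
    ∫ x in Set.Ioi (1 : ℝ), (x ^ 2)⁻¹ * (1 - (x ^ 2)⁻¹) ^ n =
      √π * Real.Gamma (n + 1) / (2 * Real.Gamma (n + 3 / 2)) := by
  induction n with
  | zero =>
    have h : ∫ x in Set.Ioi (1 : ℝ), x ^ (-2 : ℝ) = 1 := by
      rw [integral_Ioi_rpow_of_lt (by norm_num) one_pos]
      norm_num
    have hG : Real.Gamma (3 / 2) = 1 / 2 * √π := by
      rw [← Real.Gamma_one_half_eq, ← Real.Gamma_add_one (by norm_num)]
      norm_num
    have hpi : √π ≠ 0 := by positivity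
    simp only [pow_zero, mul_one, Nat.cast_zero, zero_add, Real.Gamma_one, hG]
    rw [← mul_assoc, mul_one_div_cancel two_ne_zero, one_mul, div_self hpi]
    refine (setIntegral_congr_fun measurableSet_Ioi fun x (hx : 1 < x) => ?_).trans h
    have hx0 : (0 : ℝ) ≤ x := zero_le_one.trans hx.le
    simp only [Real.rpow_neg hx0, Real.rpow_two]
  | succ n ih =>
    have h := integral_inv_sq_mul_one_sub_inv_sq_pow_succ n
    have hG : Real.Gamma ((n : ℝ) + 3 / 2) ≠ 0 := (Real.Gamma_pos_of_pos (by positivity)).ne'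
    have h1 := Real.Gamma_add_one (s := (n : ℝ) + 1) (by positivity)
    have h2 := Real.Gamma_add_one (s := (n : ℝ) + 3 / 2) (by positivity)
    have h3 : (n : ℝ) + 1 + 3 / 2 = n + 3 / 2 + 1 := by ring
    have hc : (2 * (n : ℝ) + 3) ≠ 0 := by positivity
    rw [ih] at h
    push_cast
    rw [h3, h1, h2]
    apply mul_left_cancel₀ hc
    rw [h]
    field_simp

/-- The mean of the ratio `β` with density
`g_m(β) = 2(m−1) β^{1−2m} (β²−1)^{m−2}` on `(1,∞)` equals `√π Γ(m)/Γ(m−1/2)`. -/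
theorem mean_of_ratio (m : ℕ) (hm : 2 ≤ m) :
    ∫ β in Set.Ioi (1 : ℝ),
        β * (2 * ((m : ℝ) - 1) * β ^ ((1 : ℤ) - 2 * (m : ℤ)) * (β ^ 2 - 1) ^ (m - 2)) =
      Real.sqrt π * Real.Gamma m / Real.Gamma ((m : ℝ) - 1 / 2) := by
  obtain ⟨n, rfl⟩ := Nat.exists_eq_add_of_le' hm
  have hcongr : ∀ β ∈ Set.Ioi (1 : ℝ),
      β * (2 * (((n + 2 : ℕ) : ℝ) - 1) * β ^ ((1 : ℤ) - 2 * ((n + 2 : ℕ) : ℤ)) *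
        (β ^ 2 - 1) ^ (n + 2 - 2)) =
      2 * ((n : ℝ) + 1) * ((β ^ 2)⁻¹ * (1 - (β ^ 2)⁻¹) ^ n) := by
    intro β hβ
    have h0 : β ≠ 0 := (zero_lt_one.trans hβ).ne'
    have hz : β ^ ((1 : ℤ) - 2 * ((n + 2 : ℕ) : ℤ)) = (β ^ 3)⁻¹ * ((β ^ 2) ^ n)⁻¹ := by
      rw [← mul_inv, ← pow_mul, ← pow_add, ← zpow_natCast, ← zpow_neg]
      congr 1
      push_cast
      ring
    have hp : (1 - (β ^ 2)⁻¹) ^ n = (β ^ 2 - 1) ^ n * ((β ^ 2) ^ n)⁻¹ := by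
      rw [← inv_pow (β ^ 2) n, ← mul_pow]
      congr 1
      field_simp
    rw [hz, hp, Nat.add_sub_cancel]
    push_cast
    field_simp
    ring
  rw [setIntegral_congr_fun measurableSet_Ioi hcongr, integral_const_mul,
    integral_inv_sq_mul_one_sub_inv_sq_pow]
  have h1 := Real.Gamma_add_one (s := (n : ℝ) + 1) (by positivity)
  have h2 : ((n + 2 : ℕ) : ℝ) = n + 1 + 1 := by push_cast; ring
  have h3 : (n : ℝ) + 1 + 1 - 1 / 2 = n + 3 / 2 := by ring
  rw [h2, h3, h1]
  field_simp
end

section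
/- Let m ≥ 2 be an integer and let ν ≥ 2 be a real number. Then the integral ∫_1^∞ β^ν · 2(m−1)β^{1−2m}(β²−1)^{m−2} dβ diverges (equals +∞). That is, E[β^ν] = ∞ for every ν ≥ 2, irrespective of m ≥ 2. -/
open MeasureTheory Real

theorem lintegral_ofReal_inv_Ioi_eq_top {a : ℝ} (ha : 0 ≤ a) :
    ∫⁻ x in Set.Ioi a, ENNReal.ofReal x⁻¹ = ⊤ := by
  by_contra h
  refine not_integrableOn_Ioi_inv (a := a)
    ((lintegral_ofReal_ne_top_iff_integrable ?_ ?_).1 h)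
  · exact measurable_inv.aestronglyMeasurable
  · filter_upwards [ae_restrict_mem measurableSet_Ioi] with x hx
    exact inv_nonneg.2 (ha.trans (le_of_lt hx))

/-- On `(2,∞)` the integrand `β^ν g_{k+2}(β)` dominates a multiple of `β⁻¹`. -/
theorem two_mul_half_pow_mul_inv_le (k : ℕ) {ν β : ℝ} (hν : 2 ≤ ν) (hβ : 2 < β) :
    2 * (1 / 2) ^ k * β⁻¹ ≤
      β ^ ν * (2 * (((k + 2 : ℕ) : ℝ) - 1) * β ^ ((1 : ℤ) - 2 * ((k + 2 : ℕ) : ℤ)) *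
        (β ^ 2 - 1) ^ k) := by
  have hβ0 : 0 < β := by linarith
  have hpow : β ^ 2 ≤ β ^ ν := by
    rw [← Real.rpow_natCast]
    exact Real.rpow_le_rpow_of_exponent_le (by linarith) (by exact_mod_cast hν)
  have hhalf : (1 / 2 * β ^ 2) ^ k ≤ (β ^ 2 - 1) ^ k :=
    pow_le_pow_left₀ (by positivity) (by nlinarith) k
  have hcoeff : (2 : ℝ) ≤ 2 * (((k + 2 : ℕ) : ℝ) - 1) := by
    push_cast
    linarith [k.cast_nonneg (α := ℝ)]
  have hexp : β ^ ((1 : ℤ) - 2 * ((k + 2 : ℕ) : ℤ)) = (β ^ (2 * k + 3))⁻¹ := by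
    rw [← zpow_natCast, ← zpow_neg]
    congr 1
  rw [hexp]
  calc 2 * (1 / 2) ^ k * β⁻¹
      = β ^ 2 * (2 * (β ^ (2 * k + 3))⁻¹ * (1 / 2 * β ^ 2) ^ k) := by
        rw [mul_pow, ← pow_mul, pow_add]
        field_simp
    _ ≤ _ := by gcongr

/-- For `ν ≥ 2`, the moment `E[β^ν]` of the ratio density
`g_m(β) = 2(m−1) β^{1−2m} (β²−1)^{m−2}` on `(1,∞)` is infinite, irrespective of `m ≥ 2`. -/
theorem moment_infinite (m : ℕ) (hm : 2 ≤ m) (ν : ℝ) (hν : 2 ≤ ν) :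
    ∫⁻ β in Set.Ioi (1 : ℝ),
        ENNReal.ofReal
          (β ^ ν * (2 * ((m : ℝ) - 1) * β ^ ((1 : ℤ) - 2 * (m : ℤ)) * (β ^ 2 - 1) ^ (m - 2))) =
      ⊤ := by
  obtain ⟨k, rfl⟩ := Nat.exists_eq_add_of_le' hm
  rw [Nat.add_sub_cancel, eq_top_iff]
  have hc : (0 : ℝ) < 2 * (1 / 2) ^ k := by positivity
  calc (⊤ : ENNReal)
      = ENNReal.ofReal (2 * (1 / 2) ^ k) * ∫⁻ β in Set.Ioi (2 : ℝ), ENNReal.ofReal β⁻¹ := by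
        rw [lintegral_ofReal_inv_Ioi_eq_top zero_le_two,
          ENNReal.mul_top (ENNReal.ofReal_pos.2 hc).ne']
    _ = ∫⁻ β in Set.Ioi (2 : ℝ), ENNReal.ofReal (2 * (1 / 2) ^ k * β⁻¹) := by
        rw [← lintegral_const_mul' _ _ ENNReal.ofReal_ne_top]
        simp_rw [ENNReal.ofReal_mul hc.le]
    _ ≤ ∫⁻ β in Set.Ioi (2 : ℝ), ENNReal.ofReal (β ^ ν * (2 * (((k + 2 : ℕ) : ℝ) - 1) *
          β ^ ((1 : ℤ) - 2 * ((k + 2 : ℕ) : ℤ)) * (β ^ 2 - 1) ^ k)) :=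
        setLIntegral_mono' measurableSet_Ioi fun β hβ =>
          ENNReal.ofReal_le_ofReal (two_mul_half_pow_mul_inv_le k hν hβ)
    _ ≤ _ := lintegral_mono_set (Set.Ioi_subset_Ioi one_le_two)
end

section
/- Let α > 2 be a real number and let N_t, N_r be integers with 1 ≤ N_t ≤ N_r. Define, for m ∈ (0, N_r/N_t), Φ₀(m) = (m + α/4 − 1/2)^{1−α/2} / (N_r − m N_t). Then m* = (1 − 2/α)(N_r/N_t − 1/2) lies in the open interval (0, N_r/N_t), it is the unique critical point of Φ₀ on that interval, Φ₀ is strictly decreasing on (0, m*] and strictly increasing on [m*, N_r/N_t), and hence m* is the unique global minimizer of Φ₀ on (0, N_r/N_t). -/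
open Real

/-- A function on `(a, b)` whose derivative is a positive multiple of `x - c`, with `c ∈ (a, b)`,
has `c` as its only critical point, strictly decreases before `c` and strictly increases after. -/
theorem unimodal_of_hasDerivAt {f g : ℝ → ℝ} {a b c : ℝ} (hc : c ∈ Set.Ioo a b)
    (hg : ∀ x ∈ Set.Ioo a b, 0 < g x)
    (hf : ∀ x ∈ Set.Ioo a b, HasDerivAt f (g x * (x - c)) x) :
    (∀ x ∈ Set.Ioo a b, (deriv f x = 0 ↔ x = c)) ∧
      StrictAntiOn f (Set.Ioc a c) ∧ StrictMonoOn f (Set.Ico c b) ∧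
      ∀ x ∈ Set.Ioo a b, x ≠ c → f c < f x := by
  have hanti : StrictAntiOn f (Set.Ioc a c) := by
    refine strictAntiOn_of_deriv_neg (convex_Ioc a c)
      (fun x hx => (hf x ⟨hx.1, hx.2.trans_lt hc.2⟩).continuousAt.continuousWithinAt) ?_
    intro x hx
    rw [interior_Ioc] at hx
    have hx' : x ∈ Set.Ioo a b := ⟨hx.1, hx.2.trans hc.2⟩
    rw [(hf x hx').deriv]
    exact mul_neg_of_pos_of_neg (hg x hx') (sub_neg.2 hx.2)
  have hmono : StrictMonoOn f (Set.Ico c b) := by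
    refine strictMonoOn_of_deriv_pos (convex_Ico c b)
      (fun x hx => (hf x ⟨hc.1.trans_le hx.1, hx.2⟩).continuousAt.continuousWithinAt) ?_
    intro x hx
    rw [interior_Ico] at hx
    have hx' : x ∈ Set.Ioo a b := ⟨hc.1.trans hx.1, hx.2⟩
    rw [(hf x hx').deriv]
    exact mul_pos (hg x hx') (sub_pos.2 hx.1)
  refine ⟨fun x hx => ?_, hanti, hmono, fun x hx hxc => ?_⟩
  · rw [(hf x hx).deriv, mul_eq_zero, sub_eq_zero, or_iff_right (hg x hx).ne']
  · rcases lt_or_gt_of_ne hxc with h | h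
    · exact hanti ⟨hx.1, h.le⟩ ⟨hc.1, le_rfl⟩ h
    · exact hmono ⟨le_rfl, hc.2⟩ ⟨h.le, hx.2⟩ h

/-- The derivative of `x ↦ (x + α/4 - 1/2)^(1 - α/2) / (R - x T)` in factored form. -/
theorem hasDerivAt_rpow_div_sub_mul {α T R x : ℝ} (hα : α ≠ 0) (hT : T ≠ 0)
    (hu : 0 < x + α / 4 - 1 / 2) (hv : R - x * T ≠ 0) :
    HasDerivAt (fun x : ℝ => (x + α / 4 - 1 / 2) ^ (1 - α / 2) / (R - x * T))
      ((x + α / 4 - 1 / 2) ^ (1 - α / 2 - 1) * (T * (α / 2)) / (R - x * T) ^ 2 *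
        (x - (1 - 2 / α) * (R / T - 1 / 2))) x := by
  have hbase : HasDerivAt (fun x : ℝ => x + α / 4 - 1 / 2) 1 x :=
    ((hasDerivAt_id x).add_const _).sub_const _
  have hden : HasDerivAt (fun x : ℝ => R - x * T) (-(1 * T)) x :=
    ((hasDerivAt_id x).mul_const T).const_sub R
  refine ((hbase.rpow_const (p := 1 - α / 2) (Or.inl hu.ne')).div hden hv).congr_deriv ?_
  have hpow : (x + α / 4 - 1 / 2) ^ (1 - α / 2) =
      (x + α / 4 - 1 / 2) ^ (1 - α / 2 - 1) * (x + α / 4 - 1 / 2) := by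
    rw [← rpow_add_one hu.ne', sub_add_cancel]
  rw [hpow]
  generalize (x + α / 4 - 1 / 2) ^ (1 - α / 2 - 1) = w
  field_simp
  ring

/-- For `α > 2`, `1 ≤ N_t ≤ N_r`, the function
`Φ₀(m) = (m + α/4 − 1/2)^{1−α/2} / (N_r − m N_t)` on `(0, N_r/N_t)` has
`m* = (1 − 2/α)(N_r/N_t − 1/2)` in that interval as its unique critical point; `Φ₀` is
strictly decreasing on `(0, m*]`, strictly increasing on `[m*, N_r/N_t)`, and `m*` is the
unique global minimizer of `Φ₀` on `(0, N_r/N_t)`. -/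
theorem pzf_optimal_m (α : ℝ) (hα : 2 < α) (Nt Nr : ℕ) (hNt : 1 ≤ Nt) (hle : Nt ≤ Nr) :
    (1 - 2 / α) * ((Nr : ℝ) / Nt - 1 / 2) ∈ Set.Ioo (0 : ℝ) ((Nr : ℝ) / Nt) ∧
    (∀ x ∈ Set.Ioo (0 : ℝ) ((Nr : ℝ) / Nt),
      (deriv (fun x : ℝ => (x + α / 4 - 1 / 2) ^ (1 - α / 2) / ((Nr : ℝ) - x * Nt)) x = 0 ↔
        x = (1 - 2 / α) * ((Nr : ℝ) / Nt - 1 / 2))) ∧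
    StrictAntiOn (fun x : ℝ => (x + α / 4 - 1 / 2) ^ (1 - α / 2) / ((Nr : ℝ) - x * Nt))
      (Set.Ioc (0 : ℝ) ((1 - 2 / α) * ((Nr : ℝ) / Nt - 1 / 2))) ∧
    StrictMonoOn (fun x : ℝ => (x + α / 4 - 1 / 2) ^ (1 - α / 2) / ((Nr : ℝ) - x * Nt))
      (Set.Ico ((1 - 2 / α) * ((Nr : ℝ) / Nt - 1 / 2)) ((Nr : ℝ) / Nt)) ∧
    ∀ x ∈ Set.Ioo (0 : ℝ) ((Nr : ℝ) / Nt),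
      x ≠ (1 - 2 / α) * ((Nr : ℝ) / Nt - 1 / 2) →
        (fun x : ℝ => (x + α / 4 - 1 / 2) ^ (1 - α / 2) / ((Nr : ℝ) - x * Nt))
            ((1 - 2 / α) * ((Nr : ℝ) / Nt - 1 / 2)) <
          (fun x : ℝ => (x + α / 4 - 1 / 2) ^ (1 - α / 2) / ((Nr : ℝ) - x * Nt)) x := by
  have hT : (0 : ℝ) < Nt := by exact_mod_cast hNt
  have hr : 1 ≤ (Nr : ℝ) / Nt := (one_le_div hT).2 (by exact_mod_cast hle)
  have hα0 : 0 < α := by linarith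
  have h1 : 2 / α < 1 := (div_lt_one hα0).2 hα
  have h2 : 0 < 2 / α := by positivity
  have hc : (1 - 2 / α) * ((Nr : ℝ) / Nt - 1 / 2) ∈ Set.Ioo (0 : ℝ) ((Nr : ℝ) / Nt) :=
    ⟨mul_pos (by linarith) (by linarith), by nlinarith⟩
  have hu : ∀ x ∈ Set.Ioo (0 : ℝ) ((Nr : ℝ) / Nt), 0 < x + α / 4 - 1 / 2 :=
    fun x hx => by linarith [hx.1]
  have hv : ∀ x ∈ Set.Ioo (0 : ℝ) ((Nr : ℝ) / Nt), 0 < (Nr : ℝ) - x * Nt :=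
    fun x hx => sub_pos.2 ((lt_div_iff₀ hT).1 hx.2)
  refine ⟨hc, unimodal_of_hasDerivAt hc (fun x hx => ?_) fun x hx =>
    hasDerivAt_rpow_div_sub_mul hα0.ne' hT.ne' (hu x hx) (hv x hx).ne'⟩
  have hpow := rpow_pos_of_pos (hu x hx) (1 - α / 2 - 1)
  have hden := hv x hx
  positivity
end
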